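/- Let a ∈ (−∞,1). Let w be a C² function on ℝ₊^{n+1} satisfying y·Δw(z) + a·∂_y w(z) = 0 for every z ∈ ℝ₊^{n+1} (equivalently, div(y^a ∇w) = 0). Suppose that for some constants C > 0 and d ∈ [0,1) one has |w(z)| ≤ C·y^{2−a}(1 + |z|^d) for every z = (x,y) ∈ ℝ₊^{n+1}. Then w is identically zero. -/

import Mathlib

open MeasureTheory Filter Set Topology
open scoped ENNReal NNReal

noncomputable section

/-- The Euclidean space `ℝ^{n+1}`. -/
abbrev E (n : ℕ) := EuclideanSpace ℝ (Fin (n + 1))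

/-- The last coordinate `y` of a point `z = (x, y) ∈ ℝ^{n+1}`. -/
def ycoord {n : ℕ} (z : E n) : ℝ := z (Fin.last n)

/-- The open upper half-space `ℝ₊^{n+1}`. -/
def upperHalf (n : ℕ) : Set (E n) := {z | 0 < ycoord z}

/-- The open upper half-ball `B_r⁺`. -/
def Bplus (n : ℕ) (r : ℝ) : Set (E n) := {z | 0 < ycoord z ∧ ‖z‖ < r}

/-- The upper hemisphere `(∂B_r)⁺`. -/
def sphPlus (n : ℕ) (r : ℝ) : Set (E n) := {z | 0 < ycoord z ∧ ‖z‖ = r}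

/-- The point `(x, y) ∈ ℝ^{n+1}` built from `x ∈ ℝⁿ` and `y ∈ ℝ`. -/
def pt {n : ℕ} (x : EuclideanSpace ℝ (Fin n)) (y : ℝ) : E n :=
  (EuclideanSpace.equiv (Fin (n + 1)) ℝ).symm (Fin.snoc (fun i => x i) y)

/-- The unit vector `e_{n+1}` in the `y`-direction. -/
def eY (n : ℕ) : E n := EuclideanSpace.single (Fin.last n) (1 : ℝ)

/-- The partial derivative `∂_y u` in the `y`-direction. -/
def partialY {n : ℕ} (u : E n → ℝ) (z : E n) : ℝ := fderiv ℝ u z (eY n)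

/-- The Euclidean Laplacian `Δu = ∑ ∂²u/∂z_i²`. -/
def lap {n : ℕ} (u : E n → ℝ) (z : E n) : ℝ :=
  ∑ i : Fin (n + 1),
    fderiv ℝ (fun w => fderiv ℝ u w (EuclideanSpace.single i (1 : ℝ))) z
      (EuclideanSpace.single i (1 : ℝ))

/-- A C¹ function with compact support contained in `{z : ‖z‖ ≤ r, y > 0}`. -/
def IsTestFn (n : ℕ) (r : ℝ) (φ : E n → ℝ) : Prop :=
  ContDiff ℝ 1 φ ∧ tsupport φ ⊆ {z : E n | ‖z‖ ≤ r ∧ 0 < ycoord z}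

/-- The `y^a`-weighted Sobolev energy `∫_{B_r⁺} (|∇u|² + u²) y^a dz`. -/
def wInt (n : ℕ) (a : ℝ) (u : E n → ℝ) (r : ℝ) : ℝ≥0∞ :=
  ∫⁻ z in Bplus n r, ENNReal.ofReal ((‖gradient u z‖ ^ 2 + (u z) ^ 2) * (ycoord z) ^ a)

/-- Membership in `H^{1,a}(ℝ₊^{n+1})`: locally finite weighted Sobolev norm. -/
def memH1 (n : ℕ) (a : ℝ) (u : E n → ℝ) : Prop := ∀ r > 0, wInt n a u r < ⊤

/-- Membership in `H̃^{1,a}(ℝ₊^{n+1})`: finite local weighted norm together with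
approximability by C¹ functions compactly supported away from the boundary. -/
def memH1T (n : ℕ) (a : ℝ) (u : E n → ℝ) : Prop :=
  memH1 n a u ∧ ∀ r > 0, ∃ φ : ℕ → E n → ℝ, (∀ k, IsTestFn n r (φ k)) ∧
    Tendsto (fun k => wInt n a (fun z => u z - φ k z) r) atTop (nhds 0)


theorem hda_eq {f g : ℝ → ℝ} {A B x : ℝ} (h : HasDerivAt f A x) (hf : g = f) (hA : B = A) :
    HasDerivAt g B x := by
  subst hf hA; exact h

/-- Second derivative test (necessary condition). -/
theorem second_deriv_test (φ φ' : ℝ → ℝ) (B : ℝ)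
    (h1 : ∀ᶠ t in 𝓝 (0:ℝ), HasDerivAt φ (φ' t) t) (h2 : HasDerivAt φ' B 0)
    (hmax : IsLocalMax φ 0) : φ' 0 = 0 ∧ B ≤ 0 := by
  have h0 : HasDerivAt φ (φ' 0) 0 := h1.self_of_nhds
  have e0 : φ' 0 = 0 := hmax.hasDerivAt_eq_zero h0
  refine ⟨e0, ?_⟩
  by_contra hB
  push Not at hB
  have hd : deriv φ =ᶠ[𝓝 0] φ' := h1.mono fun t ht => ht.deriv
  have hdd : deriv (deriv φ) 0 = B := by rw [hd.deriv_eq]; exact h2.deriv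
  have hmin : IsLocalMin φ 0 := by
    apply isLocalMin_of_deriv_deriv_pos
    · rw [hdd]; exact hB
    · rw [h0.deriv, e0]
    · exact h0.continuousAt
  have hc : φ =ᶠ[𝓝 0] fun _ => φ 0 := by
    filter_upwards [hmax, hmin] with t a b using le_antisymm a b
  have hd2 : deriv φ =ᶠ[𝓝 0] fun _ => 0 := by
    have := hc.deriv
    simpa using this
  have : deriv (deriv φ) 0 = 0 := by
    rw [hd2.deriv_eq]; simp
  linarith

/-- j-th unit vector. -/
def ee {n : ℕ} (j : Fin (n+1)) : E n := EuclideanSpace.single j (1 : ℝ)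

/-- Directional formulation of classical solutions. -/
structure Sol (n : ℕ) (a : ℝ) (u : E n → ℝ) (G H : Fin (n+1) → E n → ℝ) : Prop where
  cont : ContinuousOn u (upperHalf n)
  d1 : ∀ z ∈ upperHalf n, ∀ j, HasDerivAt (fun t : ℝ => u (z + t • ee j)) (G j z) 0
  d2 : ∀ z ∈ upperHalf n, ∀ j, HasDerivAt (fun t : ℝ => G j (z + t • ee j)) (H j z) 0
  pde : ∀ z ∈ upperHalf n, ycoord z * ∑ j, H j z + a * G (Fin.last n) z = 0

theorem isOpen_upperHalf (n : ℕ) : IsOpen (upperHalf n) := by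
  have : Continuous (fun z : E n => ycoord z) := by unfold ycoord; fun_prop
  exact isOpen_lt continuous_const this

theorem ee_apply {n : ℕ} (j k : Fin (n+1)) : (ee j : E n) k = if k = j then 1 else 0 := by
  simp [ee]

theorem sol_of_C2 {n : ℕ} {a : ℝ} {w : E n → ℝ} (hC2 : ContDiffOn ℝ 2 w (upperHalf n))
    (hpde : ∀ z ∈ upperHalf n, ycoord z * lap w z + a * partialY w z = 0) :
    Sol n a w (fun j z => fderiv ℝ w z (ee j))
      (fun j z => fderiv ℝ (fun x => fderiv ℝ w x (ee j)) z (ee j)) := by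
  have line : ∀ (z : E n) (j : Fin (n+1)), HasDerivAt (fun t : ℝ => z + t • ee j) (ee j) 0 := by
    intro z j
    simpa using ((hasDerivAt_id (0:ℝ)).smul_const (ee j : E n)).const_add z
  refine ⟨hC2.continuousOn, ?_, ?_, ?_⟩
  · intro z hz j
    have hd : DifferentiableAt ℝ w z :=
      (hC2.differentiableOn (by norm_num)).differentiableAt ((isOpen_upperHalf n).mem_nhds hz)
    have : HasFDerivAt w (fderiv ℝ w z) (z + (0:ℝ) • ee j) := by simpa using hd.hasFDerivAt
    exact this.comp_hasDerivAt (0:ℝ) (line z j)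
  · intro z hz j
    have h1 : ContDiffOn ℝ 1 (fderiv ℝ w) (upperHalf n) :=
      hC2.fderiv_of_isOpen (isOpen_upperHalf n) (by norm_num)
    have hd : DifferentiableAt ℝ (fderiv ℝ w) z :=
      (h1.differentiableOn (by norm_num)).differentiableAt ((isOpen_upperHalf n).mem_nhds hz)
    have hd' : DifferentiableAt ℝ (fun x => fderiv ℝ w x (ee j)) z :=
      hd.clm_apply (differentiableAt_const _)
    have : HasFDerivAt (fun x => fderiv ℝ w x (ee j))
        (fderiv ℝ (fun x => fderiv ℝ w x (ee j)) z) (z + (0:ℝ) • ee j) := by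
      simpa using hd'.hasFDerivAt
    exact this.comp_hasDerivAt (0:ℝ) (line z j)
  · intro z hz
    exact hpde z hz

theorem Sol.sub {n : ℕ} {a : ℝ} {u v : E n → ℝ} {G H G' H' : Fin (n+1) → E n → ℝ}
    (hu : Sol n a u G H) (hv : Sol n a v G' H') :
    Sol n a (fun z => u z - v z) (fun j z => G j z - G' j z) (fun j z => H j z - H' j z) := by
  refine ⟨hu.cont.sub hv.cont, fun z hz j => (hu.d1 z hz j).sub (hv.d1 z hz j),
    fun z hz j => (hu.d2 z hz j).sub (hv.d2 z hz j), fun z hz => ?_⟩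
  have := hu.pde z hz
  have := hv.pde z hz
  simp only [Finset.sum_sub_distrib]
  linarith

theorem Sol.neg {n : ℕ} {a : ℝ} {u : E n → ℝ} {G H : Fin (n+1) → E n → ℝ}
    (hu : Sol n a u G H) :
    Sol n a (fun z => - u z) (fun j z => - G j z) (fun j z => - H j z) := by
  refine ⟨hu.cont.neg, fun z hz j => (hu.d1 z hz j).neg,
    fun z hz j => (hu.d2 z hz j).neg, fun z hz => ?_⟩
  have := hu.pde z hz
  simp only [Finset.sum_neg_distrib]
  linarith

theorem upper_shift {n : ℕ} {i : Fin (n+1)} (hi : i ≠ Fin.last n) (h : ℝ) (z : E n) :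
    ycoord (z + h • ee i) = ycoord z := by
  simp [ycoord, ee_apply, hi.symm]

theorem Sol.shift {n : ℕ} {a : ℝ} {u : E n → ℝ} {G H : Fin (n+1) → E n → ℝ}
    (hu : Sol n a u G H) {i : Fin (n+1)} (hi : i ≠ Fin.last n) (h : ℝ) :
    Sol n a (fun z => u (z + h • ee i)) (fun j z => G j (z + h • ee i))
      (fun j z => H j (z + h • ee i)) := by
  have key : ∀ z ∈ upperHalf n, z + h • ee i ∈ upperHalf n := by
    intro z hz
    simpa [upperHalf, upper_shift hi] using hz
  refine ⟨hu.cont.comp (by fun_prop) key, fun z hz j => ?_, fun z hz j => ?_, fun z hz => ?_⟩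
  · have := hu.d1 _ (key z hz) j
    simpa only [add_right_comm] using this
  · have := hu.d2 _ (key z hz) j
    simpa only [add_right_comm] using this
  · have := hu.pde _ (key z hz)
    rwa [upper_shift hi] at this

/-- Reflection in the hyperplane `z_i = m`. -/
def refl' {n : ℕ} (i : Fin (n+1)) (m : ℝ) (z : E n) : E n := z - (2 * (z i - m)) • ee i

theorem Sol.refl' {n : ℕ} {a : ℝ} {u : E n → ℝ} {G H : Fin (n+1) → E n → ℝ}
    (hu : Sol n a u G H) {i : Fin (n+1)} (hi : i ≠ Fin.last n) (m : ℝ) :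
    Sol n a (fun z => u (refl' i m z))
      (fun j z => (if j = i then -1 else 1) * G j (_root_.refl' i m z))
      (fun j z => H j (_root_.refl' i m z)) := by
  have yk : ∀ z : E n, ycoord (_root_.refl' i m z) = ycoord z := by
    intro z
    simp [ycoord, _root_.refl', ee_apply, hi.symm]
  have key : ∀ z ∈ upperHalf n, _root_.refl' i m z ∈ upperHalf n := by
    intro z hz
    simpa [upperHalf, yk] using hz
  have hline : ∀ (z : E n) (j : Fin (n+1)) (t : ℝ), _root_.refl' i m (z + t • ee j)
      = _root_.refl' i m z + ((if j = i then -1 else 1) * t) • ee j := by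
    intro z j t
    by_cases hj : j = i
    · subst hj
      simp only [_root_.refl', if_true, PiLp.add_apply, PiLp.smul_apply, ee_apply, smul_eq_mul]
      module
    · have : i ≠ j := fun h => hj h.symm
      simp only [_root_.refl', if_neg hj, PiLp.add_apply, PiLp.smul_apply, ee_apply, smul_eq_mul,
        if_neg this]
      module
  have scal : ∀ (f : ℝ → ℝ) (e A : ℝ), HasDerivAt f A 0 →
      HasDerivAt (fun t => f (e * t)) (e * A) 0 := by
    intro f e A hf
    have h1 : HasDerivAt (fun t : ℝ => e * t) e 0 := by
      simpa using (hasDerivAt_id (0:ℝ)).const_mul e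
    have h2 : HasDerivAt f A (e * 0) := by simpa using hf
    have := h2.comp (0:ℝ) h1
    rwa [mul_comm] at this
  refine ⟨hu.cont.comp (by unfold _root_.refl'; fun_prop) key, fun z hz j => ?_,
    fun z hz j => ?_, fun z hz => ?_⟩
  · simp only [hline]
    exact scal _ _ _ (hu.d1 _ (key z hz) j)
  · simp only [hline]
    have := (scal _ (if j = i then -1 else 1) _ (hu.d2 _ (key z hz) j)).const_mul
      (if j = i then -1 else 1 : ℝ)
    refine hda_eq this rfl ?_
    split_ifs <;> ring
  · have := hu.pde _ (key z hz)
    rw [yk] at this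
    simp only [if_neg hi.symm, one_mul]
    exact this

theorem line_shift {n : ℕ} {f : E n → ℝ} {z : E n} {j : Fin (n+1)} {t A : ℝ}
    (h : HasDerivAt (fun s : ℝ => f (z + t • ee j + s • ee j)) A 0) :
    HasDerivAt (fun s : ℝ => f (z + s • ee j)) A t := by
  have h1 : HasDerivAt (fun s : ℝ => s - t) 1 t := by
    simpa using (hasDerivAt_id t).sub_const t
  have h2 : HasDerivAt (fun s : ℝ => f (z + t • ee j + s • ee j)) A (t - t) := by simpa using h
  have := HasDerivAt.comp (h := fun s : ℝ => s - t) t h2 h1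
  rw [mul_one] at this
  refine hda_eq this ?_ rfl
  funext s
  simp only [Function.comp]
  congr 1
  module

theorem ev_upper {n : ℕ} {z : E n} (hz : z ∈ upperHalf n) (j : Fin (n+1)) :
    ∀ᶠ t : ℝ in 𝓝 0, z + t • ee j ∈ upperHalf n := by
  have : ContinuousAt (fun t : ℝ => z + t • ee j) 0 := by fun_prop
  apply this.eventually_mem
  apply (isOpen_upperHalf n).mem_nhds
  simpa using hz

/-- At an interior maximum of `u - T`, `T` is a subsolution. -/
theorem Sol.maxpt {n : ℕ} {a : ℝ} {u : E n → ℝ} {G H : Fin (n+1) → E n → ℝ}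
    (hu : Sol n a u G H) (T : E n → ℝ) (p : E n) (hp : p ∈ upperHalf n)
    (τ : Fin (n+1) → ℝ → ℝ) (B : Fin (n+1) → ℝ)
    (h1 : ∀ j, ∀ᶠ t in 𝓝 (0:ℝ), HasDerivAt (fun t : ℝ => T (p + t • ee j)) (τ j t) t)
    (h2 : ∀ j, HasDerivAt (τ j) (B j) 0)
    (hmax : IsLocalMax (fun z => u z - T z) p) :
    0 ≤ ycoord p * ∑ j, B j + a * τ (Fin.last n) 0 := by
  have main : ∀ j, G j p - τ j 0 = 0 ∧ H j p - B j ≤ 0 := by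
    intro j
    have := second_deriv_test (fun t : ℝ => u (p + t • ee j) - T (p + t • ee j))
      (fun t => G j (p + t • ee j) - τ j t) (H j p - B j) ?_ ?_ ?_
    · simpa using this
    · filter_upwards [ev_upper hp j, h1 j] with t ht h
      exact (line_shift (hu.d1 _ ht j)).sub h
    · exact (hu.d2 p hp j).sub (h2 j)
    · have hc : ContinuousAt (fun t : ℝ => p + t • ee j) 0 := by fun_prop
      have hc' : Tendsto (fun t : ℝ => p + t • ee j) (𝓝 0) (𝓝 p) := by
        have := hc.tendsto
        simpa using this
      have := hc'.eventually hmax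
      simpa [IsLocalMax, IsMaxFilter] using this
  have hs : ∑ j, H j p ≤ ∑ j, B j := Finset.sum_le_sum fun j _ => by linarith [(main j).2]
  have := hu.pde p hp
  have hl := (main (Fin.last n)).1
  have hy : 0 < ycoord p := hp
  have := mul_le_mul_of_nonneg_left hs hy.le
  have : G (Fin.last n) p = τ (Fin.last n) 0 := by linarith
  rw [← this]
  linarith

/-- The 1D barrier computation. -/
theorem barrier_line (a μ K ρ N q s y δl δi : ℝ) (hy : 0 < y) :
    (∀ᶠ t in 𝓝 (0:ℝ), HasDerivAt (fun t : ℝ => μ * ((y + t * δl) ^ (1 - a) *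
        (N + 2 * t * q + t ^ 2 + K * (ρ * (s + t * δi) - (s + t * δi) ^ 2))))
      (μ * ((1 - a) * δl * (y + t * δl) ^ (-a) *
        (N + 2 * t * q + t ^ 2 + K * (ρ * (s + t * δi) - (s + t * δi) ^ 2))
        + (y + t * δl) ^ (1 - a) *
          (2 * q + 2 * t + K * (ρ * δi - 2 * (s + t * δi) * δi)))) t) ∧
    HasDerivAt (fun t : ℝ => (μ * ((1 - a) * δl * (y + t * δl) ^ (-a) *
        (N + 2 * t * q + t ^ 2 + K * (ρ * (s + t * δi) - (s + t * δi) ^ 2))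
        + (y + t * δl) ^ (1 - a) *
          (2 * q + 2 * t + K * (ρ * δi - 2 * (s + t * δi) * δi)))))
      (μ * ((1 - a) * (-a) * δl ^ 2 * y ^ (-a - 1) * (N + K * (ρ * s - s ^ 2))
        + 2 * (1 - a) * δl * y ^ (-a) * (2 * q + K * (ρ * δi - 2 * s * δi))
        + y ^ (1 - a) * (2 - 2 * K * δi ^ 2))) 0 := by
  have hlin : ∀ (c e t : ℝ), HasDerivAt (fun t : ℝ => c + t * e) e t := by
    intro c e t
    simpa using ((hasDerivAt_id t).mul_const e).const_add c
  have hpow : ∀ (r t : ℝ), y + t * δl ≠ 0 →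
      HasDerivAt (fun t : ℝ => (y + t * δl) ^ r) (δl * r * (y + t * δl) ^ (r - 1)) t := by
    intro r t ht
    exact (hlin y δl t).rpow_const (Or.inl ht)
  have hQ : ∀ t : ℝ, HasDerivAt (fun t : ℝ => N + 2 * t * q + t ^ 2 +
      K * (ρ * (s + t * δi) - (s + t * δi) ^ 2))
      (2 * q + 2 * t + K * (ρ * δi - 2 * (s + t * δi) * δi)) t := by
    intro t
    have h1 := (hlin N (2 * q) t)
    have h2 := hasDerivAt_pow 2 t
    have h3 := ((hlin s δi t).const_mul ρ).sub ((hlin s δi t).pow 2)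
    have := (h1.add h2).add (h3.const_mul K)
    refine hda_eq this ?_ ?_
    · funext t
      simp only [Pi.add_apply, Pi.sub_apply, Pi.pow_apply]; ring
    · norm_num
  have hQ' : ∀ t : ℝ, HasDerivAt (fun t : ℝ => 2 * q + 2 * t + K * (ρ * δi - 2 * (s + t * δi) * δi))
      (2 - 2 * K * δi ^ 2) t := by
    intro t
    have := hlin (2 * q + K * (ρ * δi - 2 * s * δi)) (2 - 2 * K * δi ^ 2) t
    refine hda_eq this ?_ rfl
    funext t
    ring
  constructor
  · have : ContinuousAt (fun t : ℝ => y + t * δl) 0 := by fun_prop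
    have ev : ∀ᶠ t : ℝ in 𝓝 0, 0 < y + t * δl := by
      apply this.eventually_const_lt
      simpa using hy
    filter_upwards [ev] with t ht
    have := ((hpow (1 - a) t ht.ne').mul (hQ t)).const_mul μ
    refine hda_eq this rfl ?_
    rw [show (1 - a - 1 : ℝ) = -a by ring]
    ring
  · have hne : y + 0 * δl ≠ 0 := by simpa using hy.ne'
    have := ((((hpow (-a) 0 hne).const_mul ((1 - a) * δl)).mul (hQ 0)).add
      ((hpow (1 - a) 0 hne).mul (hQ' 0))).const_mul μ
    refine hda_eq this rfl ?_
    rw [show (1 - a - 1 : ℝ) = -a by ring]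
    simp only [zero_mul, add_zero, mul_zero]
    ring

theorem norm_line {n : ℕ} (p c : E n) (j : Fin (n+1)) (t : ℝ) :
    ‖p + t • ee j - c‖ ^ 2 = ‖p - c‖ ^ 2 + 2 * t * (p j - c j) + t ^ 2 := by
  rw [show p + t • ee j - c = (p - c) + t • ee j by abel, norm_add_sq_real]
  have h1 : ‖t • (ee j : E n)‖ ^ 2 = t ^ 2 := by
    rw [norm_smul]; simp [ee]
  have h2 : inner ℝ (p - c) (t • (ee j : E n)) = t * (p j - c j) := by
    rw [inner_smul_right]; simp [ee, EuclideanSpace.inner_single_right]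
  rw [h1, h2]; ring

theorem barrier_bound {n : ℕ} {a : ℝ} (ha : a < 1) {f : E n → ℝ} {G H : Fin (n+1) → E n → ℝ}
    (hf : Sol n a f G H) {i : Fin (n+1)} (hi : i ≠ Fin.last n) (c : E n) (hc : c ∈ upperHalf n)
    (ρ M : ℝ) (hρ : 0 < ρ) (hM : 0 < M)
    (hz : ∀ z ∈ upperHalf n, z i = c i → f z = 0)
    (hb : ∀ z ∈ upperHalf n, ‖z - c‖ ≤ ρ → f z ≤ M * ycoord z ^ (1 - a))
    (p : E n) (hp : p ∈ upperHalf n) (hpρ : ‖p - c‖ ≤ ρ) (hpi : c i ≤ p i) :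
    f p ≤ M / ρ ^ 2 * (ycoord p ^ (1 - a) * (‖p - c‖ ^ 2
      + (n + 4 - a) * (ρ * (p i - c i) - (p i - c i) ^ 2))) := by
  set K : ℝ := n + 4 - a with hK
  set μ : ℝ := M / ρ ^ 2 with hμ
  have hμ0 : 0 < μ := by positivity
  have hK0 : 0 < K := by
    have : (0:ℝ) ≤ n := Nat.cast_nonneg n
    rw [hK]; linarith
  let T : E n → ℝ := fun z => μ * (ycoord z ^ (1 - a) * (‖z - c‖ ^ 2
      + K * (ρ * (z i - c i) - (z i - c i) ^ 2)))
  change f p ≤ T p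
  by_contra hcon
  push Not at hcon
  set η := f p - T p with hη
  have hη0 : 0 < η := by rw [hη]; linarith
  -- choose the lower cut
  obtain ⟨ε, hε0, hεp, hεη⟩ : ∃ ε : ℝ, 0 < ε ∧ ε ≤ ycoord p ∧ M * ε ^ (1 - a) < η := by
    have ht : Tendsto (fun e : ℝ => M * e ^ (1 - a)) (𝓝 0) (𝓝 (M * 0 ^ (1 - a))) :=
      ((Real.continuousAt_rpow_const 0 (1 - a) (Or.inr (by linarith))).tendsto).const_mul M
    rw [Real.zero_rpow (by linarith), mul_zero] at ht
    have e1 : ∀ᶠ e : ℝ in 𝓝 0, M * e ^ (1 - a) < η := ht.eventually_lt_const hη0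
    have e2 : ∀ᶠ e : ℝ in 𝓝 0, e < ycoord p := eventually_lt_nhds hp
    have e3 : ∀ᶠ e : ℝ in 𝓝[>] 0, M * e ^ (1 - a) < η ∧ e < ycoord p ∧ 0 < e := by
      filter_upwards [nhdsWithin_le_nhds e1, nhdsWithin_le_nhds e2, self_mem_nhdsWithin]
        with e x1 x2 x3 using ⟨x1, x2, x3⟩
    obtain ⟨e, x1, x2, x3⟩ := e3.exists
    exact ⟨e, x3, x2.le, x1⟩
  let D : Set (E n) := {z | ‖z - c‖ ≤ ρ ∧ c i ≤ z i ∧ ε ≤ ycoord z}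
  have hyc : Continuous (fun z : E n => ycoord z) := by unfold ycoord; fun_prop
  have hnc : Continuous (fun z : E n => ‖z - c‖) := by fun_prop
  have hic : Continuous (fun z : E n => z i) := by fun_prop
  have hDU : D ⊆ upperHalf n := fun z hz => lt_of_lt_of_le hε0 hz.2.2
  have hDc : IsCompact D := by
    have : IsCompact (Metric.closedBall c ρ) := isCompact_closedBall c ρ
    refine this.of_isClosed_subset ?_ ?_
    · exact (isClosed_le hnc continuous_const).inter
        ((isClosed_le continuous_const hic).inter (isClosed_le continuous_const hyc))
    · intro z hz
      simpa [Metric.mem_closedBall, dist_eq_norm] using hz.1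
  have hTc : ContinuousOn T (upperHalf n) := by
    have h1 : ContinuousOn (fun z : E n => ycoord z ^ (1 - a)) (upperHalf n) :=
      hyc.continuousOn.rpow_const fun z hz => Or.inl (ne_of_gt hz)
    refine continuousOn_const.mul (h1.mul ?_)
    fun_prop
  obtain ⟨m, hmD, hm⟩ := hDc.exists_isMaxOn ⟨p, hpρ, hpi, hεp⟩
    ((hf.cont.sub hTc).mono hDU)
  have hmU := hDU hmD
  have hmy : 0 < ycoord m := hmU
  have hmη : η ≤ f m - T m := hm (show p ∈ D from ⟨hpρ, hpi, hεp⟩)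
  -- coordinates
  have hcoord : ∀ z : E n, ‖z - c‖ ≤ ρ → z i - c i ≤ ρ := by
    intro z hz
    have := PiLp.norm_apply_le (z - c) i
    have h2 := le_abs_self (z i - c i)
    simp only [PiLp.sub_apply, Real.norm_eq_abs] at this
    linarith
  have hQ0 : 0 ≤ ρ * (m i - c i) - (m i - c i) ^ 2 := by
    have h1 := hcoord m hmD.1
    have h2 := hmD.2.1
    nlinarith
  have hyp : 0 < ycoord m ^ (1 - a) := Real.rpow_pos_of_pos hmy _
  have hT0 : 0 ≤ T m := by
    have : 0 ≤ K * (ρ * (m i - c i) - (m i - c i) ^ 2) := by positivity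
    simp only [T]
    positivity
  have hm1 : ‖m - c‖ < ρ := by
    refine lt_of_le_of_ne hmD.1 fun he => ?_
    have h1 : M * ycoord m ^ (1 - a) ≤ T m := by
      simp only [T, he, hμ]
      have h2 : 0 ≤ K * (ρ * (m i - c i) - (m i - c i) ^ 2) := by positivity
      rw [div_mul_eq_mul_div, le_div_iff₀ (by positivity)]
      have h3 : 0 ≤ M * ycoord m ^ (1 - a) := by positivity
      nlinarith [mul_nonneg h3 h2]
    have := hb m hmU hmD.1
    linarith
  have hm2 : c i < m i := by
    refine lt_of_le_of_ne hmD.2.1 fun he => ?_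
    have := hz m hmU he.symm
    linarith
  have hm3 : ε < ycoord m := by
    refine lt_of_le_of_ne hmD.2.2 fun he => ?_
    have := hb m hmU hmD.1
    rw [← he] at this
    linarith
  have hnhds : D ∈ 𝓝 m := by
    have o1 : IsOpen {z : E n | ‖z - c‖ < ρ ∧ c i < z i ∧ ε < ycoord z} :=
      (isOpen_lt hnc continuous_const).inter
        ((isOpen_lt continuous_const hic).inter (isOpen_lt continuous_const hyc))
    filter_upwards [o1.mem_nhds ⟨hm1, hm2, hm3⟩] with z hz using ⟨hz.1.le, hz.2.1.le, hz.2.2.le⟩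
  have hloc : IsLocalMax (fun z => f z - T z) m := hm.isLocalMax hnhds
  -- apply the max point lemma
  let δl : Fin (n+1) → ℝ := fun j => if j = Fin.last n then 1 else 0
  let δi : Fin (n+1) → ℝ := fun j => if j = i then 1 else 0
  have hTline : ∀ j : Fin (n+1), (fun t : ℝ => T (m + t • ee j)) = fun t : ℝ =>
      μ * ((ycoord m + t * δl j) ^ (1 - a) *
        (‖m - c‖ ^ 2 + 2 * t * (m j - c j) + t ^ 2 +
          K * (ρ * ((m i - c i) + t * δi j) - ((m i - c i) + t * δi j) ^ 2))) := by
    intro j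
    funext t
    have e1 : ycoord (m + t • ee j) = ycoord m + t * δl j := by
      simp [ycoord, ee_apply, δl, eq_comm]
    have e2 : (m + t • ee j) i - c i = (m i - c i) + t * δi j := by
      simp [ee_apply, δi, eq_comm]; ring
    simp only [T]
    rw [e1, e2, norm_line]
  have BL := fun j => barrier_line a μ K ρ (‖m - c‖ ^ 2) (m j - c j) (m i - c i) (ycoord m)
    (δl j) (δi j) hmy
  have fin := hf.maxpt T m hmU _ _ (fun j => by rw [hTline j]; exact (BL j).1)
    (fun j => (BL j).2) hloc
  have hδi : δi (Fin.last n) = 0 := by simp [δi, hi.symm]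
  have hδl : δl (Fin.last n) = 1 := by simp [δl]
  have hsum : ∑ j, (μ * ((1 - a) * (-a) * δl j ^ 2 * ycoord m ^ (-a - 1) *
        (‖m - c‖ ^ 2 + K * (ρ * (m i - c i) - (m i - c i) ^ 2))
        + 2 * (1 - a) * δl j * ycoord m ^ (-a) *
          (2 * (m j - c j) + K * (ρ * δi j - 2 * (m i - c i) * δi j))
        + ycoord m ^ (1 - a) * (2 - 2 * K * δi j ^ 2)))
      = μ * ((1 - a) * (-a) * ycoord m ^ (-a - 1) *
        (‖m - c‖ ^ 2 + K * (ρ * (m i - c i) - (m i - c i) ^ 2))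
        + 2 * (1 - a) * ycoord m ^ (-a) * (2 * (m (Fin.last n) - c (Fin.last n)))
        + ycoord m ^ (1 - a) * (2 * (n + 1) - 2 * K)) := by
    have step : ∀ j, (μ * ((1 - a) * (-a) * δl j ^ 2 * ycoord m ^ (-a - 1) *
        (‖m - c‖ ^ 2 + K * (ρ * (m i - c i) - (m i - c i) ^ 2))
        + 2 * (1 - a) * δl j * ycoord m ^ (-a) *
          (2 * (m j - c j) + K * (ρ * δi j - 2 * (m i - c i) * δi j))
        + ycoord m ^ (1 - a) * (2 - 2 * K * δi j ^ 2)))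
        = (if j = Fin.last n then μ * ((1 - a) * (-a) * ycoord m ^ (-a - 1) *
        (‖m - c‖ ^ 2 + K * (ρ * (m i - c i) - (m i - c i) ^ 2))
        + 2 * (1 - a) * ycoord m ^ (-a) * (2 * (m (Fin.last n) - c (Fin.last n)))) else 0)
        + (if j = i then μ * (ycoord m ^ (1 - a) * (- 2 * K)) else 0)
        + μ * (ycoord m ^ (1 - a) * 2) := by
      intro j
      by_cases hj : j = Fin.last n
      · subst hj
        rw [hδi, hδl, if_pos rfl, if_neg hi.symm]; ring
      · by_cases hj' : j = i
        · subst hj'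
          simp only [δl, δi, if_neg hj, if_true]; ring
        · simp only [δl, δi, if_neg hj, if_neg hj']; ring
    rw [Finset.sum_congr rfl fun j _ => step j]
    simp only [Finset.sum_add_distrib, Finset.sum_ite_eq', Finset.mem_univ, if_true,
      Finset.sum_const, Finset.card_univ, Fintype.card_fin, nsmul_eq_mul]
    push_cast
    ring
  rw [hsum, hδi, hδl] at fin
  simp only [zero_mul, mul_zero, add_zero, mul_one, sub_zero] at fin
  have hyl : m (Fin.last n) = ycoord m := rfl
  have hcl : 0 < c (Fin.last n) := hc
  rw [hyl] at fin
  set y := ycoord m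
  have r1 : y ^ (-a) = y * y ^ (-a - 1) := by
    rw [show (-a : ℝ) = 1 + (-a - 1) by ring, Real.rpow_add hmy, Real.rpow_one]; ring_nf
  have r2 : y ^ (1 - a) = y * (y * y ^ (-a - 1)) := by
    rw [← r1, sub_eq_add_neg, Real.rpow_add hmy, Real.rpow_one]
  set Y := y ^ (-a - 1) with hY
  have hY0 : 0 < Y := Real.rpow_pos_of_pos hmy _
  rw [r2, r1] at fin
  have eqn : y * (μ * ((1 - a) * (-a) * Y * (‖m - c‖ ^ 2 + K * (ρ * (m i - c i) - (m i - c i) ^ 2))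
        + 2 * (1 - a) * (y * Y) * (2 * (y - c (Fin.last n)))
        + (y * (y * Y)) * (2 * (n + 1) - 2 * K)))
      + a * (μ * ((1 - a) * (y * Y) * (‖m - c‖ ^ 2 + K * (ρ * (m i - c i) - (m i - c i) ^ 2))
        + (y * (y * Y)) * (2 * (y - c (Fin.last n)))))
      = - (μ * y ^ 2 * Y * (2 * y + 2 * (2 - a) * c (Fin.last n))) := by
    rw [hK]; ring
  have pos : 0 < μ * y ^ 2 * Y * (2 * y + 2 * (2 - a) * c (Fin.last n)) := by
    have : 0 < 2 - a := by linarith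
    positivity
  norm_num at fin eqn pos
  linarith

theorem norm_ee {n : ℕ} (j : Fin (n+1)) (t : ℝ) : ‖t • (ee j : E n)‖ = |t| := by
  rw [norm_smul]; simp [ee]

theorem diff_one_sided {n : ℕ} {a : ℝ} (ha : a < 1) {u : E n → ℝ} {G H : Fin (n+1) → E n → ℝ}
    (hu : Sol n a u G H) {i : Fin (n+1)} (hi : i ≠ Fin.last n) (C γ h : ℝ) (hC : 0 < C)
    (hγ : 0 ≤ γ) (hh : 0 < h)
    (hb : ∀ z ∈ upperHalf n, |u z| ≤ C * ycoord z ^ (1 - a) * (1 + ‖z‖) ^ γ)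
    (z : E n) (hz : z ∈ upperHalf n) (ρ : ℝ) (hρ : 1 + ‖z‖ + h ≤ ρ) :
    u (z + h • ee i) - u z ≤
      2 * C * 2 ^ γ * (h ^ 2 + (n + 4 - a) * h) * ρ ^ (γ - 1) * ycoord z ^ (1 - a) := by
  have hz0 := norm_nonneg z
  have hρ0 : 0 < ρ := by linarith
  have hρ1 : 1 ≤ ρ := by linarith
  set c : E n := z + (h / 2) • ee i with hcdef
  have hyc : ycoord c = ycoord z := upper_shift hi _ z
  have hc : c ∈ upperHalf n := by
    show 0 < ycoord c
    rw [hyc]; exact hz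
  set p : E n := z + h • ee i with hpdef
  have hyp : ycoord p = ycoord z := upper_shift hi _ z
  have hp : p ∈ upperHalf n := by
    show 0 < ycoord p
    rw [hyp]; exact hz
  have hpc : p - c = (h / 2) • ee i := by
    rw [hpdef, hcdef]; module
  have hpc' : ‖p - c‖ = h / 2 := by
    rw [hpc, norm_ee, abs_of_pos (by linarith)]
  have hpi : p i - c i = h / 2 := by
    have : (p - c) i = h / 2 := by rw [hpc]; simp [ee_apply]
    simpa using this
  have hcn : ‖c‖ ≤ ‖z‖ + h / 2 := by
    have := norm_add_le z ((h / 2) • (ee i : E n))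
    rw [norm_ee, abs_of_pos (by linarith)] at this
    exact this
  have hσ : refl' i (c i) p = z := by
    rw [refl', hpi, hpdef]; module
  have hS := hu.sub (hu.refl' hi (c i))
  have hball : ∀ x ∈ upperHalf n, ‖x - c‖ ≤ ρ → |u x| ≤ C * ycoord x ^ (1 - a) * (2 * ρ) ^ γ := by
    intro x hx hxc
    refine (hb x hx).trans ?_
    have hxp : 0 < ycoord x ^ (1 - a) := Real.rpow_pos_of_pos hx _
    have : ‖x‖ ≤ ‖x - c‖ + ‖c‖ := by simpa using norm_add_le (x - c) c
    gcongr
    linarith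
  have main := barrier_bound ha hS hi c hc ρ (2 * C * (2 * ρ) ^ γ) hρ0 (by positivity) ?_ ?_ p hp
    (by rw [hpc']; linarith) (by linarith)
  · rw [hσ, hpc', hpi, hyp] at main
    refine main.trans ?_
    have hyz : 0 < ycoord z ^ (1 - a) := Real.rpow_pos_of_pos hz _
    have e1 : ρ ^ (γ - 1) = ρ ^ γ / ρ := by rw [Real.rpow_sub hρ0, Real.rpow_one]
    have e2 : (2 * ρ) ^ γ = 2 ^ γ * ρ ^ γ := Real.mul_rpow (by norm_num) hρ0.le
    rw [e1, e2]
    have hn0 : (0:ℝ) ≤ n := Nat.cast_nonneg n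
    have hK : (0:ℝ) < n + 4 - a := by linarith
    set K : ℝ := n + 4 - a
    have e3 : (h / 2) ^ 2 + K * (ρ * (h / 2) - (h / 2) ^ 2) ≤ (h ^ 2 + K * h) * ρ := by
      have : 0 < K * h := by positivity
      have : 0 < K * h ^ 2 := by positivity
      have : h ^ 2 ≤ h ^ 2 * ρ := by nlinarith [sq_nonneg h]
      nlinarith [mul_pos ‹0 < K * h› hρ0, sq_nonneg h]
    have hg : 0 < 2 * C * (2 ^ γ * ρ ^ γ) / ρ ^ 2 * ycoord z ^ (1 - a) := by positivity
    calc 2 * C * (2 ^ γ * ρ ^ γ) / ρ ^ 2 * (ycoord z ^ (1 - a) *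
          ((h / 2) ^ 2 + K * (ρ * (h / 2) - (h / 2) ^ 2)))
        = 2 * C * (2 ^ γ * ρ ^ γ) / ρ ^ 2 * ycoord z ^ (1 - a) *
          ((h / 2) ^ 2 + K * (ρ * (h / 2) - (h / 2) ^ 2)) := by ring
      _ ≤ 2 * C * (2 ^ γ * ρ ^ γ) / ρ ^ 2 * ycoord z ^ (1 - a) * ((h ^ 2 + K * h) * ρ) :=
          mul_le_mul_of_nonneg_left e3 hg.le
      _ = _ := by field_simp
  · intro x hx hxi
    have : refl' i (c i) x = x := by simp [refl', hxi]
    simp [this]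
  · intro x hx hxc
    have e0 : refl' i (c i) x = x + (-(2 * (x i - c i))) • ee i := by rw [refl']; module
    have y0 : ycoord (refl' i (c i) x) = ycoord x := by rw [e0, upper_shift hi]
    have hx' : refl' i (c i) x ∈ upperHalf n := by
      show 0 < ycoord _
      rw [y0]; exact hx
    have n0 : ‖refl' i (c i) x - c‖ ≤ ρ := by
      have : ‖refl' i (c i) x - c‖ ^ 2 = ‖x - c‖ ^ 2 := by
        rw [e0, norm_line]; ring
      have : ‖refl' i (c i) x - c‖ = ‖x - c‖ := by
        rwa [sq_eq_sq₀ (norm_nonneg _) (norm_nonneg _)] at this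
      rw [this]; exact hxc
    have b1 := hball x hx hxc
    have b2 := hball _ hx' n0
    rw [y0] at b2
    have := (abs_le.1 b1).2
    have := (abs_le.1 b2).1
    linarith

theorem diff_bound {n : ℕ} {a : ℝ} (ha : a < 1) {u : E n → ℝ} {G H : Fin (n+1) → E n → ℝ}
    (hu : Sol n a u G H) {i : Fin (n+1)} (hi : i ≠ Fin.last n) (C γ h : ℝ) (hC : 0 < C)
    (hγ : 0 ≤ γ) (hh : 0 < h)
    (hb : ∀ z ∈ upperHalf n, |u z| ≤ C * ycoord z ^ (1 - a) * (1 + ‖z‖) ^ γ) :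
    ∃ C' : ℝ, 0 < C' ∧ ∀ z ∈ upperHalf n, ∀ ρ : ℝ, 1 + ‖z‖ + h ≤ ρ →
      |u (z + h • ee i) - u z| ≤ C' * ρ ^ (γ - 1) * ycoord z ^ (1 - a) := by
  refine ⟨2 * C * 2 ^ γ * (h ^ 2 + (n + 4 - a) * h), ?_, fun z hz ρ hρ => ?_⟩
  · have hn0 : (0:ℝ) ≤ n := Nat.cast_nonneg n
    have hK : (0:ℝ) < n + 4 - a := by linarith
    positivity
  · have h1 := diff_one_sided ha hu hi C γ h hC hγ hh hb z hz ρ hρ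
    have h2 := diff_one_sided ha hu.neg hi C γ h hC hγ hh (by simpa using hb) z hz ρ hρ
    rw [abs_le]
    constructor <;> linarith

/-- Solutions depending on `y` only and vanishing to order `2-a` vanish. -/
theorem ode_zero {n : ℕ} {a : ℝ} (ha : a < 1) {u : E n → ℝ} {G H : Fin (n+1) → E n → ℝ}
    (hu : Sol n a u G H) (C : ℝ)
    (hinv : ∀ i : Fin (n+1), i ≠ Fin.last n → ∀ h : ℝ, 0 < h → ∀ z ∈ upperHalf n,
      u (z + h • ee i) = u z)
    (hb : ∀ z ∈ upperHalf n, |u z| ≤ C * ycoord z ^ (2 - a) * (1 + ‖z‖)) :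
    ∀ z ∈ upperHalf n, u z = 0 := by
  intro z0 hz0
  have hinv' : ∀ i : Fin (n+1), i ≠ Fin.last n → ∀ h : ℝ, ∀ z ∈ upperHalf n,
      u (z + h • ee i) = u z := by
    intro i hi h z hz
    rcases lt_trichotomy h 0 with hh | hh | hh
    · have hz' : z + h • ee i ∈ upperHalf n := by
        show 0 < ycoord _
        rw [upper_shift hi]; exact hz
      have := hinv i hi (-h) (by linarith) _ hz'
      rw [← this]
      congr 1
      module
    · simp [hh]
    · exact hinv i hi h hh z hz
  have hG : ∀ i : Fin (n+1), i ≠ Fin.last n → ∀ z ∈ upperHalf n, G i z = 0 := by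
    intro i hi z hz
    have h1 := hu.d1 z hz i
    have h2 : (fun t : ℝ => u (z + t • ee i)) = fun _ => u z := by
      funext t; exact hinv' i hi t z hz
    rw [h2] at h1
    exact h1.unique (hasDerivAt_const _ _)
  have hH : ∀ i : Fin (n+1), i ≠ Fin.last n → ∀ z ∈ upperHalf n, H i z = 0 := by
    intro i hi z hz
    have h1 := hu.d2 z hz i
    have h2 : (fun t : ℝ => G i (z + t • ee i)) = fun _ => (0:ℝ) := by
      funext t
      apply hG i hi
      show 0 < ycoord _
      rw [upper_shift hi]; exact hz
    rw [h2] at h1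
    exact h1.unique (hasDerivAt_const _ _)
  have hode : ∀ z ∈ upperHalf n, ycoord z * H (Fin.last n) z + a * G (Fin.last n) z = 0 := by
    intro z hz
    have := hu.pde z hz
    rwa [Finset.sum_eq_single (Fin.last n) (fun j _ hj => hH j hj z hz) (by simp)] at this
  set y0 := ycoord z0 with hy0
  have hy0p : 0 < y0 := hz0
  let L : ℝ → E n := fun s => z0 + (s - y0) • ee (Fin.last n)
  have hL : ∀ s, ycoord (L s) = s := by
    intro s
    simp [L, ycoord, ee_apply, hy0]
  have hLU : ∀ s, 0 < s → L s ∈ upperHalf n := by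
    intro s hs
    show 0 < ycoord _
    rw [hL]; exact hs
  have along : ∀ (f : E n → ℝ) (A s : ℝ),
      HasDerivAt (fun t : ℝ => f (L s + t • ee (Fin.last n))) A 0 →
      HasDerivAt (fun t => f (L t)) A s := by
    intro f A s hf
    have h1 := line_shift (z := z0 - y0 • ee (Fin.last n)) (f := f) (t := s)
      (j := Fin.last n) (A := A) ?_
    · refine hda_eq h1 ?_ rfl
      funext t
      simp only [L]
      congr 1
      module
    · refine hda_eq hf ?_ rfl
      funext t
      simp only [L]
      congr 1
      module
  have hφ : ∀ s, 0 < s → HasDerivAt (fun t => u (L t)) (G (Fin.last n) (L s)) s :=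
    fun s hs => along u _ s (hu.d1 _ (hLU s hs) _)
  have hφ' : ∀ s, 0 < s → HasDerivAt (fun t => G (Fin.last n) (L t)) (H (Fin.last n) (L s)) s :=
    fun s hs => along _ _ s (hu.d2 _ (hLU s hs) _)
  have hψ : ∀ s, 0 < s → HasDerivAt (fun t : ℝ => t ^ a * G (Fin.last n) (L t)) 0 s := by
    intro s hs
    have := (Real.hasDerivAt_rpow_const (p := a) (Or.inl hs.ne')).mul (hφ' s hs)
    refine hda_eq this rfl ?_
    have e := hode _ (hLU s hs)
    rw [hL] at e
    have e2 : s ^ a = s * s ^ (a - 1) := by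
      rw [show a = 1 + (a - 1) by ring, Real.rpow_add hs, Real.rpow_one]; ring_nf
    rw [e2]
    linear_combination (- s ^ (a - 1)) * e
  have constOn : ∀ f : ℝ → ℝ, (∀ s, 0 < s → HasDerivAt f 0 s) → ∀ s, 0 < s → f s = f 1 := by
    intro f hf s hs
    exact isOpen_Ioi.is_const_of_deriv_eq_zero (s := Ioi (0:ℝ)) isPreconnected_Ioi
      (fun x hx => (hf x hx).differentiableAt.differentiableWithinAt)
      (fun x hx => (hf x hx).deriv) hs (by norm_num : (1:ℝ) ∈ Ioi (0:ℝ))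
  set B := (1:ℝ) ^ a * G (Fin.last n) (L 1) with hBdef
  have hB : ∀ s, 0 < s → G (Fin.last n) (L s) = B * s ^ (-a) := by
    intro s hs
    have e : s ^ a * G (Fin.last n) (L s) = B := constOn _ hψ s hs
    rw [← e, Real.rpow_neg hs.le]
    have := Real.rpow_pos_of_pos hs a
    field_simp
  have h1a : (1 - a) ≠ 0 := by linarith
  have hχ : ∀ s, 0 < s → HasDerivAt (fun t : ℝ => u (L t) - B / (1 - a) * t ^ (1 - a)) 0 s := by
    intro s hs
    have := (hφ s hs).sub ((Real.hasDerivAt_rpow_const (p := 1 - a)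
      (Or.inl hs.ne')).const_mul (B / (1 - a)))
    refine hda_eq this rfl ?_
    rw [hB s hs, show (1 - a - 1 : ℝ) = -a by ring]
    field_simp
    ring
  set A := u (L 1) - B / (1 - a) * (1:ℝ) ^ (1 - a) with hAdef
  have hsol : ∀ s, 0 < s → u (L s) = A + B / (1 - a) * s ^ (1 - a) := by
    intro s hs
    have := constOn _ hχ s hs
    rw [← hAdef] at this
    linarith
  set B' := B / (1 - a) with hB'
  have hbound : ∀ s, 0 < s → |A + B' * s ^ (1 - a)| ≤ C * s ^ (2 - a) * (1 + ‖L s‖) := by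
    intro s hs
    have := hb _ (hLU s hs)
    rwa [hL, hsol s hs] at this
  have hLc : Continuous L := by fun_prop
  have t0 : ∀ r : ℝ, 0 < r → Tendsto (fun s : ℝ => s ^ r) (𝓝[>] 0) (𝓝 0) := by
    intro r hr
    have := (Real.continuousAt_rpow_const 0 r (Or.inr hr.le)).tendsto
    rw [Real.zero_rpow hr.ne'] at this
    exact this.mono_left nhdsWithin_le_nhds
  have tL : Tendsto (fun s : ℝ => 1 + ‖L s‖) (𝓝[>] 0) (𝓝 (1 + ‖L 0‖)) := by
    have : Continuous (fun s : ℝ => 1 + ‖L s‖) := by fun_prop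
    exact (this.tendsto 0).mono_left nhdsWithin_le_nhds
  have hA0 : A = 0 := by
    have l1 : Tendsto (fun s : ℝ => |A + B' * s ^ (1 - a)|) (𝓝[>] 0) (𝓝 |A + B' * 0|) :=
      (((t0 (1 - a) (by linarith)).const_mul B').const_add A).abs
    have l2 : Tendsto (fun s : ℝ => C * s ^ (2 - a) * (1 + ‖L s‖)) (𝓝[>] 0)
        (𝓝 (C * 0 * (1 + ‖L 0‖))) := ((t0 (2 - a) (by linarith)).const_mul C).mul tL
    have := le_of_tendsto_of_tendsto l1 l2
      (by filter_upwards [self_mem_nhdsWithin] with s hs using hbound s hs)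
    simpa using this
  have hB0 : B' = 0 := by
    have l2 : Tendsto (fun s : ℝ => C * s ^ (1:ℝ) * (1 + ‖L s‖)) (𝓝[>] 0)
        (𝓝 (C * 0 * (1 + ‖L 0‖))) := ((t0 1 (by linarith)).const_mul C).mul tL
    have := ge_of_tendsto (b := |B'|) l2
      (by
        filter_upwards [self_mem_nhdsWithin] with s hs
        have hs' : 0 < s := hs
        have b := hbound s hs'
        have hp := Real.rpow_pos_of_pos hs' (1 - a)
        rw [hA0, zero_add, abs_mul, abs_of_pos hp, show (2 - a : ℝ) = 1 + (1 - a) by ring,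
          Real.rpow_add hs'] at b
        refine le_of_mul_le_mul_right (b.trans_eq ?_) hp
        ring)
    simpa using this
  have := hsol y0 hy0p
  rw [hA0, hB0] at this
  simpa [L] using this

/-- Liouville-type theorem for `Δ_a w = 0`, `a < 1`, under the growth bound
`|w(z)| ≤ C y^{2-a}(1 + |z|^d)` for some `d ∈ [0,1)`. -/
theorem liouville_degenerate_vanishing_growth
    (n : ℕ) (hn : 1 ≤ n) (a : ℝ) (ha : a < 1)
    (w : E n → ℝ)
    (hC2 : ContDiffOn ℝ 2 w (upperHalf n))
    (hpde : ∀ z ∈ upperHalf n, ycoord z * lap w z + a * partialY w z = 0)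
    (C : ℝ) (hC : 0 < C) (d : ℝ) (hd : d ∈ Set.Ico (0 : ℝ) 1)
    (hgrowth : ∀ z ∈ upperHalf n, |w z| ≤ C * (ycoord z) ^ (2 - a) * (1 + ‖z‖ ^ d)) :
    ∀ z ∈ upperHalf n, w z = 0 := by
  obtain ⟨hd0, hd1⟩ := hd
  have hw := sol_of_C2 hC2 hpde
  have hyn : ∀ z : E n, ycoord z ≤ ‖z‖ := fun z =>
    (le_abs_self _).trans (PiLp.norm_apply_le z (Fin.last n))
  -- first growth bound
  have hg1 : ∀ z ∈ upperHalf n,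
      |w z| ≤ (2 * C) * ycoord z ^ (1 - a) * (1 + ‖z‖) ^ (1 + d) := by
    intro z hz
    have hy : 0 < ycoord z := hz
    have hn0 := norm_nonneg z
    refine (hgrowth z hz).trans ?_
    rw [show (2 - a : ℝ) = 1 + (1 - a) by ring, Real.rpow_add hy, Real.rpow_one,
      Real.rpow_add (by linarith : 0 < 1 + ‖z‖), Real.rpow_one]
    have h1 : ‖z‖ ^ d ≤ (1 + ‖z‖) ^ d := Real.rpow_le_rpow hn0 (by linarith) hd0
    have h2 : 1 ≤ (1 + ‖z‖) ^ d := Real.one_le_rpow (by linarith) hd0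
    have h3 : ycoord z ≤ 1 + ‖z‖ := (hyn z).trans (by linarith)
    have hp := Real.rpow_pos_of_pos hy (1 - a)
    calc C * (ycoord z * ycoord z ^ (1 - a)) * (1 + ‖z‖ ^ d)
        ≤ C * ((1 + ‖z‖) * ycoord z ^ (1 - a)) * (2 * (1 + ‖z‖) ^ d) := by
          gcongr; linarith
      _ = _ := by ring
  -- bound with order of vanishing
  have hg2 : ∀ z ∈ upperHalf n, |w z| ≤ (2 * C) * ycoord z ^ (2 - a) * (1 + ‖z‖) := by
    intro z hz
    have hn0 := norm_nonneg z
    refine (hgrowth z hz).trans ?_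
    have h1 : ‖z‖ ^ d ≤ (1 + ‖z‖) ^ d := Real.rpow_le_rpow hn0 (by linarith) hd0
    have h2 : (1 + ‖z‖) ^ d ≤ (1 + ‖z‖) ^ (1:ℝ) :=
      Real.rpow_le_rpow_of_exponent_le (by linarith) hd1.le
    rw [Real.rpow_one] at h2
    have hp := Real.rpow_pos_of_pos (show 0 < ycoord z from hz) (2 - a)
    have hp' : 0 < C * ycoord z ^ (2 - a) := by positivity
    nlinarith
  refine ode_zero ha hw (2 * C) ?_ hg2
  intro i hi h hh
  have hu := (hw.shift hi h).sub hw
  obtain ⟨C1, hC1, hb1⟩ := diff_bound ha hw hi (2 * C) (1 + d) h (by linarith) (by linarith) hh hg1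
  have hg3 : ∀ z ∈ upperHalf n, |w (z + h • ee i) - w z| ≤
      (C1 * (1 + h) ^ d) * ycoord z ^ (1 - a) * (1 + ‖z‖) ^ d := by
    intro z hz
    have hn0 := norm_nonneg z
    refine (hb1 z hz _ le_rfl).trans ?_
    have hp := Real.rpow_pos_of_pos (show 0 < ycoord z from hz) (1 - a)
    have h1 : (1 + ‖z‖ + h) ^ (1 + d - 1) ≤ (1 + h) ^ d * (1 + ‖z‖) ^ d := by
      rw [← Real.mul_rpow (by linarith) (by linarith), show 1 + d - 1 = d by ring]
      apply Real.rpow_le_rpow (by linarith) _ hd0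
      nlinarith
    calc C1 * (1 + ‖z‖ + h) ^ (1 + d - 1) * ycoord z ^ (1 - a)
        ≤ C1 * ((1 + h) ^ d * (1 + ‖z‖) ^ d) * ycoord z ^ (1 - a) := by gcongr
      _ = _ := by ring
  have hg4 : ∀ z ∈ upperHalf n, |w (z + h • ee i) - w z| ≤
      (2 * C * (2 + h)) * ycoord z ^ (2 - a) * (1 + ‖z‖) := by
    intro z hz
    have hn0 := norm_nonneg z
    have hz' : z + h • ee i ∈ upperHalf n := by
      show 0 < ycoord _
      rw [upper_shift hi]; exact hz
    have b1 := hg2 z hz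
    have b2 := hg2 _ hz'
    rw [upper_shift hi] at b2
    have b3 : ‖z + h • ee i‖ ≤ ‖z‖ + h := by
      have := norm_add_le z (h • (ee i : E n))
      rwa [norm_ee, abs_of_pos hh] at this
    have hp := Real.rpow_pos_of_pos (show 0 < ycoord z from hz) (2 - a)
    have hp' : 0 < 2 * C * ycoord z ^ (2 - a) := by positivity
    calc |w (z + h • ee i) - w z| ≤ |w (z + h • ee i)| + |w z| := abs_sub _ _
      _ ≤ 2 * C * ycoord z ^ (2 - a) * (1 + ‖z + h • ee i‖)
          + 2 * C * ycoord z ^ (2 - a) * (1 + ‖z‖) := add_le_add b2 b1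
      _ = 2 * C * ycoord z ^ (2 - a) * ((1 + ‖z + h • ee i‖) + (1 + ‖z‖)) := by ring
      _ ≤ 2 * C * ycoord z ^ (2 - a) * ((2 + h) * (1 + ‖z‖)) := by
          apply mul_le_mul_of_nonneg_left _ hp'.le
          nlinarith
      _ = _ := by ring
  have hzero := ode_zero ha hu (2 * C * (2 + h)) ?_ hg4
  · intro z hz
    have := hzero z hz
    linarith
  · intro k hk h' hh' z hz
    obtain ⟨C2, hC2', hb2⟩ := diff_bound ha hu hk (C1 * (1 + h) ^ d) d h' (by positivity) hd0 hh' hg3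
    have l1 : Tendsto (fun ρ : ℝ => C2 * ρ ^ (d - 1) * ycoord z ^ (1 - a)) atTop
        (𝓝 (C2 * 0 * ycoord z ^ (1 - a))) := by
      have := tendsto_rpow_neg_atTop (y := 1 - d) (by linarith)
      rw [neg_sub] at this
      exact (this.const_mul C2).mul_const _
    have l2 := ge_of_tendsto l1 (by
      filter_upwards [eventually_ge_atTop (1 + ‖z‖ + h')] with ρ hρ using hb2 z hz ρ hρ)
    rw [mul_zero, zero_mul] at l2
    have := abs_nonpos_iff.1 l2
    linarith

end
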